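/- Let Λ be a lattice of full rank in ℝ^n and let Λ₁ be a full-rank sublattice of Λ. Assume B₁ > 2ν(Λ₁). For a coset c ∈ Λ/Λ₁, let P(c) = |{λ ∈ Λ ∩ [0,B₁)^n : λ + Λ₁ = c}| / |Λ ∩ [0,B₁)^n| be the probability that a uniformly random element of Λ ∩ [0,B₁)^n reduces to c modulo Λ₁. Then the total variation distance (1/2) Σ_{c ∈ Λ/Λ₁} |P(c) − 1/[Λ:Λ₁]| between this distribution and the uniform distribution on Λ/Λ₁ is at most 1 − (B₁ − 2ν(Λ₁))^n / (B₁ + 2ν(Λ))^n. -/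

import Mathlib

/-- The covering radius of a lattice: the supremum over `x` of the distance from `x`
to the nearest lattice point. -/
noncomputable def covRad {n : ℕ} (Λ : Submodule ℤ (EuclideanSpace ℝ (Fin n))) : ℝ :=
  ⨆ x : EuclideanSpace ℝ (Fin n), Metric.infDist x (Λ : Set (EuclideanSpace ℝ (Fin n)))

/-- The half-open cube `[0, B)^n`. -/
def cube (n : ℕ) (B : ℝ) : Set (EuclideanSpace ℝ (Fin n)) :=
  {x | ∀ i, 0 ≤ x i ∧ x i < B}

open MeasureTheory

/-- The half-open cube `[a, b)^n`. -/
def icoCube (n : ℕ) (a b : ℝ) : Set (EuclideanSpace ℝ (Fin n)) :=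
  {x | ∀ i, a ≤ x i ∧ x i < b}

theorem icoCube_eq_preimage (n : ℕ) (a b : ℝ) :
    icoCube n a b = WithLp.ofLp ⁻¹' (Set.univ.pi fun _ : Fin n => Set.Ico a b) := by
  ext x
  simp [icoCube]

theorem measurableSet_icoCube (n : ℕ) (a b : ℝ) : MeasurableSet (icoCube n a b) := by
  rw [icoCube_eq_preimage]
  exact (PiLp.volume_preserving_ofLp (Fin n)).measurable
    (MeasurableSet.univ_pi fun _ => measurableSet_Ico)

theorem volume_icoCube (n : ℕ) (a b : ℝ) :
    volume (icoCube n a b) = ENNReal.ofReal (b - a) ^ n := by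
  rw [icoCube_eq_preimage, (PiLp.volume_preserving_ofLp (Fin n)).measure_preimage
    (MeasurableSet.univ_pi fun _ => measurableSet_Ico).nullMeasurableSet]
  simp [volume_pi_pi]

theorem isBounded_cube (n : ℕ) (B : ℝ) : Bornology.IsBounded (cube n B) := by
  refine (PiLp.antilipschitzWith_ofLp 2 (fun _ : Fin n => ℝ)).isBounded_preimage
    (Metric.isBounded_Icc (fun _ => (0 : ℝ)) (fun _ => B)) |>.subset fun x hx => ?_
  exact ⟨fun i => (hx i).1, fun i => (hx i).2.le⟩

theorem finite_lattice_inter_cube {n : ℕ} (L : Submodule ℤ (EuclideanSpace ℝ (Fin n)))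
    [DiscreteTopology L] (B : ℝ) :
    ((L : Set (EuclideanSpace ℝ (Fin n))) ∩ cube n B).Finite := by
  rw [Set.inter_comm]
  exact Metric.finite_isBounded_inter_isClosed (s := (L : Set (EuclideanSpace ℝ (Fin n))))
    (isDiscrete_iff_discreteTopology.mpr ‹_›) (isBounded_cube n B)
    (@AddSubgroup.isClosed_of_discrete _ _ _ _ _ L.toAddSubgroup ‹_›)

section

variable {n : ℕ} (L : Submodule ℤ (EuclideanSpace ℝ (Fin n))) [DiscreteTopology L] [IsZLattice ℝ L]

/-- Every point is within the covering radius of some lattice point. -/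
theorem exists_mem_norm_sub_le_covRad (x : EuclideanSpace ℝ (Fin n)) :
    ∃ v ∈ L, ‖x - v‖ ≤ covRad L := by
  have hcl : IsClosed (L : Set (EuclideanSpace ℝ (Fin n))) :=
    @AddSubgroup.isClosed_of_discrete _ _ _ _ _ L.toAddSubgroup ‹_›
  obtain ⟨v, hv, hd⟩ := hcl.exists_infDist_eq_dist ⟨0, L.zero_mem⟩ x
  refine ⟨v, hv, ?_⟩
  rw [← dist_eq_norm, ← hd]
  let b := (Module.Free.chooseBasis ℤ L).ofZLatticeBasis ℝ L
  refine le_ciSup (f := fun x => Metric.infDist x (L : Set (EuclideanSpace ℝ (Fin n))))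
    ⟨∑ i, ‖b i‖, ?_⟩ x
  rintro _ ⟨y, rfl⟩
  have hmem : (ZSpan.floor b y : EuclideanSpace ℝ (Fin n)) ∈ L :=
    ((Module.Free.chooseBasis ℤ L).ofZLatticeBasis_span ℝ).le (ZSpan.floor b y).2
  calc Metric.infDist y L ≤ dist y (ZSpan.floor b y) := Metric.infDist_le_dist_of_mem hmem
    _ = ‖ZSpan.fract b y‖ := by rw [dist_eq_norm, ZSpan.fract_apply]
    _ ≤ _ := ZSpan.norm_fract_le b y

theorem covRad_nonneg : 0 ≤ covRad L := by
  obtain ⟨v, -, hv⟩ := exists_mem_norm_sub_le_covRad L 0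
  exact (norm_nonneg _).trans hv

/-- The volume of a set is the integral, over a fundamental domain `D` of volume the covolume, of
the number of its points in each translate of the lattice. -/
theorem exists_volume_eq_lintegral_encard :
    ∃ D : Set (EuclideanSpace ℝ (Fin n)), volume D = ENNReal.ofReal (ZLattice.covolume L) ∧
      ∀ S, MeasurableSet S →
        volume S = ∫⁻ x in D, (({g : L | (g : EuclideanSpace ℝ (Fin n)) + x ∈ S}.encard : ℕ∞) :
          ENNReal) := by
  have : MeasurableVAdd L (EuclideanSpace ℝ (Fin n)) :=
    (inferInstance : MeasurableVAdd L.toAddSubgroup _)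
  have : VAddInvariantMeasure L (EuclideanSpace ℝ (Fin n)) volume :=
    (inferInstance : VAddInvariantMeasure L.toAddSubgroup _ volume)
  have hD := ZLattice.isAddFundamentalDomain (Module.Free.chooseBasis ℤ L) volume
  refine ⟨ZSpan.fundamentalDomain ((Module.Free.chooseBasis ℤ L).ofZLatticeBasis ℝ L),
    ?_, fun S hS => ?_⟩
  · rw [ZLattice.covolume_eq_measure_fundamentalDomain L volume hD, measureReal_def,
      ENNReal.ofReal_toReal]
    exact (ZSpan.fundamentalDomain_isBounded _).measure_lt_top.ne
  · rw [← lintegral_indicator_one hS, hD.lintegral_eq_tsum'', ← lintegral_tsum]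
    · refine lintegral_congr fun x => ?_
      rw [← ENNReal.tsum_set_one, tsum_subtype {g : L | _} fun _ => (1 : ENNReal)]
      rfl
    · exact fun g => ((measurable_one.indicator hS).comp (measurable_const_vadd g)).aemeasurable

theorem volume_le_mul_covolume {S : Set (EuclideanSpace ℝ (Fin n))} (hS : MeasurableSet S) {k : ℕ}
    (h : ∀ x, {g : L | (g : EuclideanSpace ℝ (Fin n)) + x ∈ S}.encard ≤ k) :
    volume S ≤ ENNReal.ofReal (k * ZLattice.covolume L) := by
  obtain ⟨D, hD, hvol⟩ := exists_volume_eq_lintegral_encard L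
  rw [hvol S hS, ENNReal.ofReal_mul k.cast_nonneg, ← hD, ENNReal.ofReal_natCast,
    ← setLIntegral_const]
  exact lintegral_mono fun x => by simpa using ENat.toENNReal_mono (h x)

theorem mul_covolume_le_volume {S : Set (EuclideanSpace ℝ (Fin n))} (hS : MeasurableSet S) {k : ℕ}
    (h : ∀ x, k ≤ {g : L | (g : EuclideanSpace ℝ (Fin n)) + x ∈ S}.encard) :
    ENNReal.ofReal (k * ZLattice.covolume L) ≤ volume S := by
  obtain ⟨D, hD, hvol⟩ := exists_volume_eq_lintegral_encard L
  rw [hvol S hS, ENNReal.ofReal_mul k.cast_nonneg, ← hD, ENNReal.ofReal_natCast,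
    ← setLIntegral_const]
  exact lintegral_mono fun x => by simpa using ENat.toENNReal_mono (h x)

/-- The number of lattice points in a cube is at most the volume of the cube enlarged by the
covering radius, divided by the covolume. -/
theorem ncard_inter_cube_mul_covolume_le {B : ℝ} (hB : 0 ≤ B) :
    ((L : Set (EuclideanSpace ℝ (Fin n))) ∩ cube n B).ncard * ZLattice.covolume L ≤
      (B + 2 * covRad L) ^ n := by
  have hν := covRad_nonneg L
  have hk := mul_covolume_le_volume L (measurableSet_icoCube n (-covRad L) (B + covRad L))
    (k := ((L : Set (EuclideanSpace ℝ (Fin n))) ∩ cube n B).ncard) fun x => by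
      obtain ⟨v, hv, hxv⟩ := exists_mem_norm_sub_le_covRad L x
      rw [(finite_lattice_inter_cube L B).cast_ncard_eq,
        ← Subtype.val_injective.encard_image {g : L | _}]
      refine Set.encard_le_encard_of_injOn (f := fun w => w - v) ?_ (sub_left_injective.injOn)
      rintro w ⟨hwL, hw⟩
      refine ⟨⟨w - v, L.sub_mem hwL hv⟩, fun i => ?_, rfl⟩
      have hi := abs_le.mp ((PiLp.norm_apply_le (x - v) i).trans hxv)
      have := hw i
      simp only [PiLp.add_apply, PiLp.sub_apply] at hi ⊢
      constructor <;> linarith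
  rw [volume_icoCube, ← ENNReal.ofReal_pow (by linarith),
    ENNReal.ofReal_le_ofReal_iff (pow_nonneg (by linarith) n)] at hk
  convert hk using 2
  ring

/-- The number of points of a translate of a lattice in a cube is at least the volume of the cube
shrunk by the covering radius, divided by the covolume. -/
theorem le_ncard_translate_mul_covolume {B : ℝ} (hB : 2 * covRad L < B)
    (y : EuclideanSpace ℝ (Fin n)) {A : Set (EuclideanSpace ℝ (Fin n))} (hA : A.Finite)
    (hAy : ∀ g ∈ L, g + y ∈ cube n B → g + y ∈ A) :
    (B - 2 * covRad L) ^ n ≤ A.ncard * ZLattice.covolume L := by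
  have hk := volume_le_mul_covolume L (measurableSet_icoCube n (covRad L) (B - covRad L))
    (k := A.ncard) fun x => by
      obtain ⟨v, hv, hxv⟩ := exists_mem_norm_sub_le_covRad L (x - y)
      rw [hA.cast_ncard_eq]
      refine Set.encard_le_encard_of_injOn
        (f := fun g : L => (g : EuclideanSpace ℝ (Fin n)) + v + y) ?_ ?_
      · rintro g hg
        refine hAy _ (L.add_mem g.2 hv) fun i => ?_
        have hi := abs_le.mp ((PiLp.norm_apply_le (x - y - v) i).trans hxv)
        have := hg i
        simp only [PiLp.add_apply, PiLp.sub_apply] at hi this ⊢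
        constructor <;> linarith
      · intro g _ g' _ h
        simpa using h
  rw [volume_icoCube, ← ENNReal.ofReal_pow (by linarith),
    ENNReal.ofReal_le_ofReal_iff
      (mul_nonneg (Nat.cast_nonneg _) (ZLattice.covolume_pos L volume).le)] at hk
  convert hk using 2
  ring

end

/-- If a probability vector `p` is bounded below by `δ` times the uniform one, then its total
variation distance to the uniform one is at most `1 - δ`. -/
theorem half_sum_abs_sub_uniform_le {ι : Type*} [Fintype ι] [Nonempty ι] (p : ι → ℝ) {δ : ℝ}
    (hδ : δ ≤ 1) (hsum : ∑ i, p i = 1) (hp : ∀ i, δ / Fintype.card ι ≤ p i) :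
    (1 / 2) * ∑ i, |p i - 1 / Fintype.card ι| ≤ 1 - δ := by
  have hm : (0 : ℝ) < Fintype.card ι := by exact_mod_cast Fintype.card_pos
  have hle : ∀ i, |p i - 1 / Fintype.card ι| ≤
      p i + 1 / Fintype.card ι - 2 * (δ / Fintype.card ι) := fun i => by
    have h1 := hp i
    have h2 : δ / Fintype.card ι ≤ 1 / Fintype.card ι := by gcongr
    rw [abs_le]
    constructor <;> linarith
  have h := Finset.sum_le_sum fun i (_ : i ∈ Finset.univ) => hle i
  rw [Finset.sum_sub_distrib, Finset.sum_add_distrib, hsum] at h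
  simp only [Finset.sum_const, Finset.card_univ, nsmul_eq_mul] at h
  have e : (Fintype.card ι : ℝ) * (1 / Fintype.card ι) = 1 := by field_simp
  have e' : (Fintype.card ι : ℝ) * (2 * (δ / Fintype.card ι)) = 2 * δ := by field_simp
  linarith

theorem sampling_quotient_tv_bound (n : ℕ)
    (Λ Λ₁ : Submodule ℤ (EuclideanSpace ℝ (Fin n)))
    [DiscreteTopology Λ] [IsZLattice ℝ Λ]
    [DiscreteTopology Λ₁] [IsZLattice ℝ Λ₁]
    (hsub : Λ₁ ≤ Λ) (B₁ : ℝ) (hB₁ : B₁ > 2 * covRad Λ₁)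
    (P : (Λ ⧸ Λ₁.comap Λ.subtype) → ℝ)
    (hP : ∀ c, P c =
      ({x : Λ | (x : EuclideanSpace ℝ (Fin n)) ∈ cube n B₁ ∧
          Submodule.Quotient.mk x = c}.ncard : ℝ) /
        (((Λ : Set (EuclideanSpace ℝ (Fin n))) ∩ cube n B₁).ncard : ℝ)) :
    (1 / 2) * ∑ᶠ c : Λ ⧸ Λ₁.comap Λ.subtype,
        |P c - 1 / (Nat.card (Λ ⧸ Λ₁.comap Λ.subtype) : ℝ)| ≤
      1 - (B₁ - 2 * covRad Λ₁) ^ n / (B₁ + 2 * covRad Λ) ^ n := by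
  have hν := covRad_nonneg Λ
  have hν₁ := covRad_nonneg Λ₁
  let v := ZLattice.covolume Λ
  let v₁ := ZLattice.covolume Λ₁
  have hv : 0 < v := ZLattice.covolume_pos Λ volume
  have hv₁ : 0 < v₁ := ZLattice.covolume_pos Λ₁ volume
  have hindex : v₁ / v = Nat.card (Λ ⧸ Λ₁.comap Λ.subtype) :=
    ZLattice.covolume_div_covolume_eq_relIndex' Λ₁ Λ hsub
  have hm : (0 : ℝ) < Nat.card (Λ ⧸ Λ₁.comap Λ.subtype) := hindex ▸ div_pos hv₁ hv
  have : Finite (Λ ⧸ Λ₁.comap Λ.subtype) :=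
    (Nat.card_pos_iff.mp (by exact_mod_cast hm)).2
  cases nonempty_fintype (Λ ⧸ Λ₁.comap Λ.subtype)
  set N : (Λ ⧸ Λ₁.comap Λ.subtype) → ℕ := fun c =>
    {x : Λ | (x : EuclideanSpace ℝ (Fin n)) ∈ cube n B₁ ∧ Submodule.Quotient.mk x = c}.ncard with hN
  set T := ((Λ : Set (EuclideanSpace ℝ (Fin n))) ∩ cube n B₁).ncard with hT
  have hfin := finite_lattice_inter_cube Λ B₁
  have hfin' : {x : Λ | (x : EuclideanSpace ℝ (Fin n)) ∈ cube n B₁}.Finite :=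
    Set.Finite.of_finite_image (f := Subtype.val)
      (hfin.subset (by rintro _ ⟨x, hx, rfl⟩; exact ⟨x.2, hx⟩)) Subtype.val_injective.injOn
  have hNT : ∑ c, N c = T := by
    classical
    have hT' : T = hfin'.toFinset.card := by
      rw [hT, ← Set.ncard_eq_toFinset_card _ hfin',
        ← Set.ncard_image_of_injective _ Subtype.val_injective]
      congr 1
      ext x
      simp [and_comm]
    rw [hT', Finset.card_eq_sum_card_fiberwise (f := fun x : Λ =>
      (Submodule.Quotient.mk x : Λ ⧸ Λ₁.comap Λ.subtype)) (t := Finset.univ) (by simp)]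
    refine Finset.sum_congr rfl fun c _ => ?_
    rw [← Set.ncard_coe_finset]
    simp [hN]
  have hlow : ∀ c, (B₁ - 2 * covRad Λ₁) ^ n ≤ N c * v₁ := fun c => by
    obtain ⟨y, rfl⟩ := Submodule.Quotient.mk_surjective _ c
    rw [hN]
    dsimp only
    rw [← Set.ncard_image_of_injective _ Subtype.val_injective]
    refine le_ncard_translate_mul_covolume Λ₁ hB₁ y
      ((hfin'.subset fun x hx => hx.1).image _) fun g hg hgy => ?_
    refine ⟨⟨g, hsub hg⟩ + y, ⟨hgy, ?_⟩, rfl⟩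
    rw [Submodule.Quotient.eq]
    simpa using hg
  have hup : T * v ≤ (B₁ + 2 * covRad Λ) ^ n :=
    ncard_inter_cube_mul_covolume_le Λ (by linarith)
  have hnum : 0 < (B₁ - 2 * covRad Λ₁) ^ n := pow_pos (by linarith) n
  have hden : 0 < (B₁ + 2 * covRad Λ) ^ n := pow_pos (by linarith) n
  have hTpos : (0 : ℝ) < T := by
    have h0 : N 0 ≤ T := hNT ▸ Finset.single_le_sum (fun _ _ => Nat.zero_le _) (Finset.mem_univ 0)
    have h1 : (0 : ℝ) < N 0 := pos_of_mul_pos_left (hnum.trans_le (hlow 0)) hv₁.le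
    exact h1.trans_le (by exact_mod_cast h0)
  rw [finsum_eq_sum_of_fintype, Nat.card_eq_fintype_card]
  rw [Nat.card_eq_fintype_card] at hindex hm
  refine half_sum_abs_sub_uniform_le P ?_ ?_ fun c => ?_
  · rw [div_le_one hden]
    exact pow_le_pow_left₀ (by linarith) (by linarith) n
  · simp_rw [hP, ← Finset.sum_div]
    rw [div_eq_one_iff_eq hTpos.ne', ← hNT]
    push_cast
    rfl
  · rw [show P c = N c / T from hP c, ← hindex, div_div, div_le_div_iff₀ (by positivity) hTpos]
    calc (B₁ - 2 * covRad Λ₁) ^ n * T ≤ N c * v₁ * T := by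
          gcongr
          exact hlow c
      _ = N c * (T * v * (v₁ / v)) := by
          field_simp
      _ ≤ N c * ((B₁ + 2 * covRad Λ) ^ n * (v₁ / v)) := by
          gcongr
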